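/- arXiv:1312.6623 — 2 statements merged into one kernel-verified Lean document; each statement's English description precedes it below -/
import Mathlib

section
/- Let a : ℕ≥1 → ℂ satisfy: a(1) = 1; a(mn) = a(m)a(n) whenever gcd(m,n) = 1; a(p^{r+1}) = a(p)·a(p^r) - p^{19}·a(p^{r-1}) for every prime p and every r ≥ 1; a(2) = 456; and |a(n)| ≤ C·n^c for all n, for some real constants C, c (these are the Hecke relations satisfied by the Fourier coefficients of the normalized cusp eigenform g₂₀ of weight 20 and level 1). Let b(n) = ∑_{d | n, d odd} d. Then for every complex s with Re(s) > max(c+2, 11), all the following series and products converge absolutely and one has [∏_{p odd prime} (1 - p^{20-2s})^{-1}] · ∑_{n=1}^∞ a(n) b(n) n^{-s} = (1 - 456·2^{1-s} + 2^{21-2s}) · (∑_{n=1}^∞ a(n) n^{-s}) · (∑_{n=1}^∞ a(n) n^{-(s-1)}). Equivalently, L(s, g₂₀ ⊗ G_{2,2}) = (1 - 456·2^{1-s} + 2^{21-2s}) · L(s, g₂₀) · L(s-1, g₂₀). -/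
open Finset

open scoped ArithmeticFunction.zeta

/-- The identity on odd numbers, extended by zero. -/
noncomputable def oddId : ArithmeticFunction ℂ :=
  ⟨fun n => if Odd n then (n : ℂ) else 0, by simp⟩

lemma oddId_apply (n : ℕ) : oddId n = if Odd n then (n : ℂ) else 0 := rfl

lemma oddId_isMultiplicative : oddId.IsMultiplicative := by
  refine ⟨by simp [oddId_apply], fun {m n} _ => ?_⟩
  simp only [oddId_apply, Nat.odd_mul]
  by_cases hm : Odd m <;> by_cases hn : Odd n <;> simp [hm, hn]

/-- The sum of the odd divisors. -/
noncomputable def oddDivisorSum : ArithmeticFunction ℂ :=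
  oddId * (ζ : ArithmeticFunction ℂ)

lemma oddDivisorSum_apply (n : ℕ) :
    oddDivisorSum n = ∑ d ∈ n.divisors.filter (fun d => Odd d), (d : ℂ) := by
  rw [oddDivisorSum, ArithmeticFunction.coe_mul_zeta_apply, Finset.sum_filter]
  rfl

lemma oddDivisorSum_isMultiplicative : oddDivisorSum.IsMultiplicative :=
  oddId_isMultiplicative.mul ArithmeticFunction.isMultiplicative_zeta.natCast

lemma oddDivisorSum_two_pow (r : ℕ) : oddDivisorSum (2 ^ r) = 1 := by
  rw [oddDivisorSum, ArithmeticFunction.coe_mul_zeta_apply,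
    Nat.sum_divisors_prime_pow Nat.prime_two, Finset.sum_range_succ']
  simp [oddId_apply, Nat.odd_pow_iff]

lemma sub_one_mul_oddDivisorSum_prime_pow {p : ℕ} (hp : p.Prime) (hp2 : p ≠ 2) (r : ℕ) :
    ((p : ℂ) - 1) * oddDivisorSum (p ^ r) = (p : ℂ) ^ (r + 1) - 1 := by
  rw [oddDivisorSum, ArithmeticFunction.coe_mul_zeta_apply, Nat.sum_divisors_prime_pow hp,
    ← mul_geom_sum]
  simp [oddId_apply, (hp.odd_of_ne_two hp2).pow]

lemma oddDivisorSum_LSeriesSummable {w : ℂ} (hw : 2 < w.re) :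
    LSeriesSummable (fun n => oddDivisorSum n) w := by
  refine ArithmeticFunction.LSeriesSummable_mul ?_ ?_
  · refine LSeriesSummable_of_le_const_mul_rpow hw ⟨1, fun n _ => ?_⟩
    rw [oddId_apply]
    norm_num
    split_ifs <;> simp
  · exact ArithmeticFunction.LSeriesSummable_zeta_iff.mpr (by linarith)

/-- The generating series of a second-order linear recurrence. -/
lemma tsum_mul_pow_mul_eq_one_of_recurrence {u : ℕ → ℂ} {A P x : ℂ} (h0 : u 0 = 1) (h1 : u 1 = A)
    (hrec : ∀ r, u (r + 2) = A * u (r + 1) - P * u r) (hs : Summable fun r => u r * x ^ r) :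
    (∑' r, u r * x ^ r) * (1 - A * x + P * x ^ 2) = 1 := by
  have hs1 : Summable fun r => u (r + 1) * x ^ (r + 1) := (summable_nat_add_iff 1).mpr hs
  have e1 := hs.tsum_eq_zero_add
  have e2 := hs1.tsum_eq_zero_add
  have e3 : ∑' r, u (r + 1 + 1) * x ^ (r + 1 + 1) =
      A * x * ∑' r, u (r + 1) * x ^ (r + 1) - P * x ^ 2 * ∑' r, u r * x ^ r := by
    rw [← tsum_mul_left, ← tsum_mul_left, ← (hs1.mul_left _).tsum_sub (hs.mul_left _)]
    refine tsum_congr fun r => ?_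
    rw [hrec]
    ring
  simp only [h0, zero_add, h1, pow_zero, pow_one, mul_one] at e1 e2
  linear_combination e1 + e2 + e3 - (A * x) * e1

lemma Nat.cast_pow_cpow (p r : ℕ) (w : ℂ) : ((p ^ r : ℕ) : ℂ) ^ w = ((p : ℂ) ^ w) ^ r := by
  induction r with
  | zero => simp
  | succ r ih => rw [pow_succ, Nat.cast_mul, Complex.natCast_mul_natCast_cpow, ih, pow_succ]

lemma one_sub_sq_mul_tsum_eq {u v : ℕ → ℂ} {A P q x : ℂ} (hq : q ≠ 1)
    (h0 : u 0 = 1) (h1 : u 1 = A)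
    (hrec : ∀ r, u (r + 2) = A * u (r + 1) - P * u r)
    (hv : ∀ r, (q - 1) * v r = q ^ (r + 1) - 1)
    (hs : Summable fun r => u r * x ^ r) (hs' : Summable fun r => u r * (q * x) ^ r) :
    ∑' r, u r * v r * x ^ r =
      (1 - P * q * x ^ 2) * (∑' r, u r * x ^ r) * ∑' r, u r * (q * x) ^ r := by
  have e1 := tsum_mul_pow_mul_eq_one_of_recurrence h0 h1 hrec hs
  have e2 := tsum_mul_pow_mul_eq_one_of_recurrence h0 h1 hrec hs'
  have e3 : (q - 1) * ∑' r, u r * v r * x ^ r =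
      q * (∑' r, u r * (q * x) ^ r) - ∑' r, u r * x ^ r := by
    rw [← tsum_mul_left, ← tsum_mul_left, ← (hs'.mul_left _).tsum_sub hs]
    refine tsum_congr fun r => ?_
    linear_combination (u r * x ^ r) * hv r
  apply mul_left_cancel₀ (sub_ne_zero.mpr hq)
  rw [e3]
  linear_combination (-q * ∑' r, u r * (q * x) ^ r) * e1 + (∑' r, u r * x ^ r) * e2

lemma summable_norm_mul_cpow {a b : ℕ → ℂ} {C c : ℝ}
    (hgrowth : ∀ n : ℕ, 1 ≤ n → ‖a n‖ ≤ C * (n : ℝ) ^ c) {s : ℂ} (hs : s ≠ 0)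
    (hb : LSeriesSummable b (s - c)) :
    Summable fun n : ℕ => ‖a n * b n * (n : ℂ) ^ (-s)‖ := by
  refine (hb.norm.mul_left C).of_nonneg_of_le (fun _ => norm_nonneg _) fun n => ?_
  rcases Nat.eq_zero_or_pos n with rfl | hn
  · simp [hs]
  · have hn' : (0 : ℝ) < n := by exact_mod_cast hn
    rw [LSeries.norm_term_eq, if_neg hn.ne', norm_mul, norm_mul,
      Complex.norm_natCast_cpow_of_pos hn]
    calc ‖a n‖ * ‖b n‖ * (n : ℝ) ^ (-s).re ≤ C * (n : ℝ) ^ c * ‖b n‖ * (n : ℝ) ^ (-s).re := by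
          gcongr
          exact hgrowth n hn
      _ = _ := by
          rw [Complex.sub_re, Complex.ofReal_re, Real.rpow_sub hn', Complex.neg_re,
            Real.rpow_neg hn'.le]
          field_simp

/-- The Euler product of the zeta function with the factor at `2` removed. -/
lemma odd_eulerProduct_hasProd {w : ℂ} (hw : 1 < w.re) :
    ∃ Z : ℂ, HasProd (fun p : {p : ℕ // p.Prime ∧ p ≠ 2} => (1 - (p.1 : ℂ) ^ (-w))⁻¹) Z ∧
      HasProd (fun p : Nat.Primes => if p.1 = 2 then 1 else (1 - (p.1 : ℂ) ^ (-w))⁻¹) Z := by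
  have h := DirichletCharacter.LSeries_eulerProduct_hasProd (1 : DirichletCharacter ℂ 2) hw
  have e : (fun p : Nat.Primes => (1 - (1 : DirichletCharacter ℂ 2) p * (p : ℂ) ^ (-w))⁻¹) =
      fun p : Nat.Primes => if p.1 = 2 then 1 else (1 - (p.1 : ℂ) ^ (-w))⁻¹ := by
    funext p
    split_ifs with hp
    · have : ((p.1 : ℕ) : ZMod 2) = 0 := by rw [hp]; rfl
      rw [this, MulChar.map_nonunit _ (by simp)]
      simp
    · have : IsUnit ((p.1 : ℕ) : ZMod 2) :=
        (ZMod.isUnit_iff_coprime _ _).mpr ((Nat.coprime_primes p.2 Nat.prime_two).mpr hp)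
      rw [MulChar.one_apply this, one_mul]
  rw [e] at h
  refine ⟨_, ?_, h⟩
  let g : {p : ℕ // p.Prime ∧ p ≠ 2} → Nat.Primes := fun p => ⟨p.1, p.2.1⟩
  have hg : Function.Injective g := fun p q hpq =>
    Subtype.ext (Subtype.mk.inj hpq)
  have := (hg.hasProd_iff (f := fun p : Nat.Primes =>
    if p.1 = 2 then 1 else (1 - (p.1 : ℂ) ^ (-w))⁻¹) (fun p hp => if_pos (by
      by_contra h2
      exact hp ⟨⟨p.1, p.2, h2⟩, rfl⟩))).mpr h
  refine this.congr_fun fun p => ?_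
  exact (if_neg p.2.2).symm

set_option maxHeartbeats 1000000 in
theorem stmt_5 (a : ℕ → ℂ)
    (ha1 : a 1 = 1)
    (hamul : ∀ m n : ℕ, Nat.Coprime m n → a (m * n) = a m * a n)
    (hHecke : ∀ p : ℕ, p.Prime → ∀ r : ℕ, 1 ≤ r →
      a (p ^ (r + 1)) = a p * a (p ^ r) - (p : ℂ) ^ 19 * a (p ^ (r - 1)))
    (ha2 : a 2 = 456)
    (C c : ℝ)
    (hgrowth : ∀ n : ℕ, 1 ≤ n → ‖a n‖ ≤ C * (n : ℝ) ^ c) :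
    ∀ s : ℂ, max (c + 2) 11 < s.re →
      Summable (fun n : ℕ =>
        ‖a (n + 1) * (∑ d ∈ (n + 1).divisors.filter (fun d => Odd d), (d : ℂ)) *
          ((n + 1 : ℕ) : ℂ) ^ (-s)‖) ∧
      Summable (fun n : ℕ => ‖a (n + 1) * ((n + 1 : ℕ) : ℂ) ^ (-s)‖) ∧
      Summable (fun n : ℕ => ‖a (n + 1) * ((n + 1 : ℕ) : ℂ) ^ (-(s - 1))‖) ∧
      Multipliable (fun p : {p : ℕ // p.Prime ∧ p ≠ 2} =>
        (1 - (p.1 : ℂ) ^ (20 - 2 * s))⁻¹) ∧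
      (∏' p : {p : ℕ // p.Prime ∧ p ≠ 2}, (1 - (p.1 : ℂ) ^ (20 - 2 * s))⁻¹) *
          (∑' n : ℕ, a (n + 1) * (∑ d ∈ (n + 1).divisors.filter (fun d => Odd d), (d : ℂ)) *
            ((n + 1 : ℕ) : ℂ) ^ (-s)) =
        (1 - 456 * (2 : ℂ) ^ (1 - s) + (2 : ℂ) ^ (21 - 2 * s)) *
          (∑' n : ℕ, a (n + 1) * ((n + 1 : ℕ) : ℂ) ^ (-s)) *
          (∑' n : ℕ, a (n + 1) * ((n + 1 : ℕ) : ℂ) ^ (-(s - 1))) := by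
  intro s hs
  obtain ⟨hs1, hs2⟩ := max_lt_iff.mp hs
  have hs0 : s ≠ 0 := fun h => by norm_num [h] at hs2
  have hs0' : s - 1 ≠ 0 := sub_ne_zero.mpr fun h => by norm_num [h] at hs2
  simp_rw [← oddDivisorSum_apply]
  have hone {w : ℂ} (hw : 1 < w.re) : LSeriesSummable (fun _ => 1) w :=
    LSeriesSummable_of_le_const_mul_rpow hw ⟨1, by simp⟩
  have sH : Summable fun n : ℕ => ‖a n * oddDivisorSum n * (n : ℂ) ^ (-s)‖ :=
    summable_norm_mul_cpow hgrowth hs0 (oddDivisorSum_LSeriesSummable (by simp; linarith))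
  have sF : Summable fun n : ℕ => ‖a n * (n : ℂ) ^ (-s)‖ := by
    simpa using summable_norm_mul_cpow (b := fun _ => 1) hgrowth hs0 (hone (by simp; linarith))
  have sG : Summable fun n : ℕ => ‖a n * (n : ℂ) ^ (-(s - 1))‖ := by
    simpa using summable_norm_mul_cpow (b := fun _ => 1) hgrowth hs0' (hone (by simp; linarith))
  obtain ⟨Z, hZ, hZ'⟩ := odd_eulerProduct_hasProd (w := 2 * s - 20) (by simp; linarith)
  rw [neg_sub] at hZ hZ'
  refine ⟨(summable_nat_add_iff 1).mpr sH, (summable_nat_add_iff 1).mpr sF,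
    (summable_nat_add_iff 1).mpr sG, hZ.multipliable, ?_⟩
  have shift {f : ℕ → ℂ} (hf : Summable fun n => ‖f n‖) (h0 : f 0 = 0) :
      ∑' n, f (n + 1) = ∑' n, f n := by
    rw [hf.of_norm.tsum_eq_zero_add, h0, zero_add]
  have H0 : a 0 * oddDivisorSum 0 * ((0 : ℕ) : ℂ) ^ (-s) = 0 := by simp
  have F0 : a 0 * ((0 : ℕ) : ℂ) ^ (-s) = 0 := by simp [hs0]
  have G0 : a 0 * ((0 : ℕ) : ℂ) ^ (-(s - 1)) = 0 := by
    rw [Nat.cast_zero, Complex.zero_cpow (neg_ne_zero.mpr hs0'), mul_zero]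
  rw [hZ.tprod_eq, shift sH H0, shift sF F0, shift sG G0]
  have pH := EulerProduct.eulerProduct_hasProd
    (by simp [ha1, oddDivisorSum_isMultiplicative.map_one])
    (fun {m n} h => by
      rw [hamul m n h, oddDivisorSum_isMultiplicative.map_mul_of_coprime h, Nat.cast_mul,
        Complex.natCast_mul_natCast_cpow]
      ring) sH H0
  have pmul (w : ℂ) {m n : ℕ} (h : m.Coprime n) :
      a (m * n) * ((m * n : ℕ) : ℂ) ^ w = a m * (m : ℂ) ^ w * (a n * (n : ℂ) ^ w) := by
    rw [hamul m n h, Nat.cast_mul, Complex.natCast_mul_natCast_cpow]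
    ring
  have pF := EulerProduct.eulerProduct_hasProd (by simp [ha1]) (pmul _) sF F0
  have pG := EulerProduct.eulerProduct_hasProd (by simp [ha1]) (pmul _) sG G0
  have pE := hasProd_ite_eq (⟨2, Nat.prime_two⟩ : Nat.Primes)
    (1 - 456 * (2 : ℂ) ^ (1 - s) + (2 : ℂ) ^ (21 - 2 * s))
  refine (hZ'.mul pH).unique ?_
  refine ((pE.mul pF).mul pG).congr_fun fun p => ?_
  obtain ⟨p, hp⟩ := p
  have hp0 : (p : ℂ) ≠ 0 := by exact_mod_cast hp.ne_zero
  have powG : (p : ℂ) ^ (-(s - 1)) = p * (p : ℂ) ^ (-s) := by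
    rw [show -(s - 1) = 1 + -s by ring, Complex.cpow_add _ _ hp0, Complex.cpow_one]
  have pow2 (k : ℕ) : (p : ℂ) ^ (k - 2 * s) = (p : ℂ) ^ k * ((p : ℂ) ^ (-s)) ^ 2 := by
    rw [show (k : ℂ) - 2 * s = k + (-s + -s) by ring, Complex.cpow_add _ _ hp0,
      Complex.cpow_add _ _ hp0, Complex.cpow_natCast]
    ring
  have h0 : a (p ^ 0) = 1 := by rw [pow_zero, ha1]
  have h1 : a (p ^ 1) = a p := by rw [pow_one]
  have hrec (r : ℕ) : a (p ^ (r + 2)) = a p * a (p ^ (r + 1)) - (p : ℂ) ^ 19 * a (p ^ r) :=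
    hHecke p hp (r + 1) (by omega)
  have inj := Nat.pow_right_injective hp.two_le
  have lF := sF.of_norm.comp_injective inj
  have lG := sG.of_norm.comp_injective inj
  simp only [Function.comp_def, Nat.cast_pow_cpow, powG] at lF lG
  simp only [Nat.cast_pow_cpow, powG]
  by_cases hp2 : p = 2
  · subst hp2
    have e2 := tsum_mul_pow_mul_eq_one_of_recurrence (u := fun r => a (2 ^ r)) h0 h1 hrec lG
    have e21 := pow2 21
    rw [show (1 - s) = -(s - 1) by ring]
    push_cast at e2 e21 powG lG ⊢
    simp only [oddDivisorSum_two_pow, mul_one, if_true, one_mul]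
    rw [e21, powG]
    rw [ha2] at e2
    linear_combination (-∑' r, a (2 ^ r) * ((2 : ℂ) ^ (-s)) ^ r) * e2
  · have hne : (1 : ℂ) - (p : ℂ) ^ (20 - 2 * s) ≠ 0 := by
      refine sub_ne_zero.mpr fun h => ?_
      have hlt : ‖(p : ℂ) ^ (20 - 2 * s)‖ < 1 := by
        rw [Complex.norm_natCast_cpow_of_pos hp.pos]
        exact Real.rpow_lt_one_of_one_lt_of_neg (by exact_mod_cast hp.one_lt)
          (by simp; linarith)
      rw [← h] at hlt
      simp at hlt
    have key := one_sub_sq_mul_tsum_eq (u := fun r => a (p ^ r))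
      (v := fun r => oddDivisorSum (p ^ r)) (q := p) (by exact_mod_cast hp.ne_one) h0 h1 hrec
      (sub_one_mul_oddDivisorSum_prime_pow hp hp2) lF lG
    have e20 := pow2 20
    push_cast at e20
    have hpp : (⟨p, hp⟩ : Nat.Primes) ≠ ⟨2, Nat.prime_two⟩ := fun h => hp2 (congrArg Subtype.val h)
    simp only [hp2, hpp, if_false, one_mul]
    rw [inv_mul_eq_iff_eq_mul₀ hne, key, e20]
    ring
end

section
/- Let m be an odd integer, let z be a point of the upper half-plane, and let φ : ℕ≥1 → ℂ satisfy |φ(n)| ≤ C·n^M for some constants C, M (polynomial growth). Then the double series ∑ sgn(d) · d^m · e^{πi d} · φ(d d'/2) · e^{πi d d' z}, taken over all pairs (d, d') ∈ ℤ² with d d' > 0 and d' even, converges absolutely and equals 2 · ∑_{n=1}^∞ (∑_{d | n} (-1)^d d^m) · φ(n) · e^{2πi n z}. -/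
open Finset Complex

/-- The pair `(ε d, 2 ε n / d)` attached to a sign `ε` and a divisor `d` of `n`, where the
positive integer `n` is given by its predecessor. -/
def signedDivisorPair (x : ℤˣ × (Σ n : ℕ, {d : ℕ // d ∈ (n + 1).divisors})) :
    {dd : ℤ × ℤ // 0 < dd.1 * dd.2 ∧ 2 ∣ dd.2} :=
  ⟨((x.1 : ℤ) * (x.2.2.1 : ℕ), (x.1 : ℤ) * (2 * ((x.2.1 + 1) / x.2.2.1 : ℕ))), by
    obtain ⟨ε, n, d, hd⟩ := x
    have hdvd := Nat.dvd_of_mem_divisors hd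
    have hprod : ((d * ((n + 1) / d) : ℕ) : ℤ) = n + 1 := by
      rw [Nat.mul_div_cancel' hdvd]; push_cast; rfl
    refine ⟨?_, Dvd.dvd.mul_left (Dvd.intro _ rfl) _⟩
    have hε : (ε : ℤ) * ε = 1 := by rw [← Units.val_mul, Int.units_mul_self, Units.val_one]
    calc (0 : ℤ) < 2 * (n + 1) := by positivity
      _ = (ε * ε) * (2 * ((d * ((n + 1) / d) : ℕ) : ℤ)) := by rw [hprod, hε, one_mul]
      _ = _ := by push_cast; ring⟩

theorem signedDivisorPair_injective : Function.Injective signedDivisorPair := by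
  rintro ⟨ε, n, d, hd⟩ ⟨ε', n', d', hd'⟩ h
  have hdpos := Nat.pos_of_mem_divisors hd
  have hdpos' := Nat.pos_of_mem_divisors hd'
  have h₁ := congrArg (fun y => y.1.1) h
  have h₂ := congrArg (fun y => y.1.2) h
  simp only [signedDivisorPair] at h₁ h₂
  have hpair : ε = ε' ∧ d = d' := by
    rcases Int.units_eq_one_or ε with rfl | rfl <;> rcases Int.units_eq_one_or ε' with rfl | rfl <;>
      simp only [Units.val_one, Units.val_neg] at h₁ <;> first
      | exact ⟨rfl, by omega⟩
      | exact absurd h₁ (by omega)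
  obtain ⟨rfl, rfl⟩ := hpair
  have hq : (n + 1) / d = (n' + 1) / d := by
    have := mul_left_cancel₀ (Units.ne_zero ε) h₂
    omega
  have hn : n = n' := by
    have e := Nat.mul_div_cancel' (Nat.dvd_of_mem_divisors hd)
    have e' := Nat.mul_div_cancel' (Nat.dvd_of_mem_divisors hd')
    rw [hq] at e
    omega
  subst hn
  rfl

theorem signedDivisorPair_surjective : Function.Surjective signedDivisorPair := by
  have key : ∀ (ε : ℤˣ) (a c : ℕ), 0 < a → 0 < c → ∃ x, (signedDivisorPair x).1 =
      ((ε : ℤ) * a, (ε : ℤ) * (2 * c)) := by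
    intro ε a c ha hc
    have hac : a * c - 1 + 1 = a * c := Nat.sub_add_cancel (Nat.mul_pos ha hc)
    refine ⟨⟨ε, a * c - 1, a, ?_⟩, ?_⟩
    · rw [hac]
      exact Nat.mem_divisors.2 ⟨Dvd.intro _ rfl, (Nat.mul_pos ha hc).ne'⟩
    · simp only [signedDivisorPair, hac, Nat.mul_div_cancel_left _ ha]
  rintro ⟨⟨a, b⟩, hpos, c, hc⟩
  dsimp only at hpos hc
  subst hc
  rcases pos_and_pos_or_neg_and_neg_of_mul_pos hpos with ⟨ha, hb⟩ | ⟨ha, hb⟩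
  · obtain ⟨x, hx⟩ := key 1 a.natAbs c.natAbs (by omega) (by omega)
    refine ⟨x, Subtype.ext (hx.trans (Prod.ext ?_ ?_))⟩ <;> simp only [Units.val_one] <;> omega
  · obtain ⟨x, hx⟩ := key (-1) a.natAbs c.natAbs (by omega) (by omega)
    refine ⟨x, Subtype.ext (hx.trans (Prod.ext ?_ ?_))⟩ <;>
      simp only [Units.val_one, Units.val_neg] <;> omega

/-- The value of the summand of the double series at `(ε d, 2 ε n / d)`. -/
theorem summand_signedDivisorPair {m : ℤ} (hm : Odd m) (z : ℂ) (φ : ℕ → ℂ) (ε : ℤˣ)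
    {n d q : ℕ} (hd : 0 < d) (hdq : d * q = n) :
    ((((ε : ℤ) * (d : ℤ)).sign : ℤ) : ℂ) * (((ε : ℤ) * (d : ℤ) : ℤ) : ℂ) ^ m *
        Complex.exp ((Real.pi : ℂ) * Complex.I * (((ε : ℤ) * (d : ℤ) : ℤ) : ℂ)) *
        φ (((ε : ℤ) * (d : ℤ) * ((ε : ℤ) * (2 * (q : ℤ))) / 2).toNat) *
        Complex.exp ((Real.pi : ℂ) * Complex.I * (((ε : ℤ) * (d : ℤ) : ℤ) : ℂ) *
          (((ε : ℤ) * (2 * (q : ℤ)) : ℤ) : ℂ) * z) =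
      (-1 : ℂ) ^ d * (d : ℂ) ^ m * φ n *
        Complex.exp (2 * (Real.pi : ℂ) * Complex.I * (n : ℂ) * z) := by
  have hε : (ε : ℤ) * ε = 1 := by rw [← Units.val_mul, Int.units_mul_self, Units.val_one]
  have hεC : ((ε : ℤ) : ℂ) * ((ε : ℤ) : ℂ) = 1 := by exact_mod_cast hε
  have hφ : ((ε : ℤ) * (d : ℤ) * ((ε : ℤ) * (2 * (q : ℤ))) / 2).toNat = n := by
    have : (ε : ℤ) * (d : ℤ) * ((ε : ℤ) * (2 * (q : ℤ))) = 2 * (n : ℤ) := by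
      rw [← hdq]; push_cast; linear_combination (2 * (d : ℤ) * q) * hε
    omega
  have hexp : (Real.pi : ℂ) * Complex.I * (((ε : ℤ) * (d : ℤ) : ℤ) : ℂ) *
      (((ε : ℤ) * (2 * (q : ℤ)) : ℤ) : ℂ) * z = 2 * (Real.pi : ℂ) * Complex.I * (n : ℂ) * z := by
    rw [← hdq]; push_cast
    linear_combination (Real.pi * Complex.I * d * (2 * q) * z) * hεC
  have hsign : ((((ε : ℤ) * (d : ℤ)).sign : ℤ) : ℂ) * (((ε : ℤ) * (d : ℤ) : ℤ) : ℂ) ^ m =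
      (d : ℂ) ^ m := by
    have hd' : (d : ℤ).sign = 1 := Int.sign_eq_one_of_pos (by exact_mod_cast hd)
    rcases Int.units_eq_one_or ε with rfl | rfl
    · simp [hd']
    · simp [hd', hm.neg_zpow]
  have hpi : Complex.exp ((Real.pi : ℂ) * Complex.I * (((ε : ℤ) * (d : ℤ) : ℤ) : ℂ)) =
      (-1 : ℂ) ^ d := by
    rw [mul_comm, Complex.exp_int_mul, Complex.exp_pi_mul_I]
    rcases Int.units_eq_one_or ε with rfl | rfl
    · simp
    · simp [← inv_pow]
  rw [hφ, hexp, hsign, hpi]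
  ring

/-- Summing a polynomially bounded multiple of `(-1) ^ d * d ^ m * e ^ (2 π i n z)` over all
divisors `d` of all positive integers `n` converges absolutely. -/
theorem summable_norm_sigma_divisors (m : ℤ) {z : ℂ} (hz : 0 < z.im) {φ : ℕ → ℂ} {C M : ℝ}
    (hφ : ∀ n : ℕ, 1 ≤ n → ‖φ n‖ ≤ C * (n : ℝ) ^ M) :
    Summable (fun x : (Σ n : ℕ, {d : ℕ // d ∈ (n + 1).divisors}) =>
      ‖(-1 : ℂ) ^ x.2.1 * (x.2.1 : ℂ) ^ m * φ (x.1 + 1) *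
        Complex.exp (2 * (Real.pi : ℂ) * Complex.I * ((x.1 + 1 : ℕ) : ℂ) * z)‖) := by
  set r : ℝ := 2 * Real.pi * z.im
  have hr : 0 < r := by positivity
  set k : ℕ := 1 + m.natAbs + ⌈M⌉₊
  have hgeom : Summable fun n : ℕ =>
      |C| * (((n + 1 : ℕ) : ℝ) ^ k * Real.exp (-r * ((n + 1 : ℕ) : ℝ))) :=
    ((summable_nat_add_iff 1).2 (Real.summable_pow_mul_exp_neg_nat_mul k hr)).mul_left _
  rw [summable_sigma_of_nonneg fun _ => norm_nonneg _]
  refine ⟨fun n => (hasSum_fintype _).summable, ?_⟩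
  refine Summable.of_nonneg_of_le (fun n => tsum_nonneg fun _ => norm_nonneg _) (fun n => ?_) hgeom
  set N : ℕ := n + 1
  have hN : (1 : ℝ) ≤ N := by exact_mod_cast Nat.succ_pos n
  have hexp : ‖Complex.exp (2 * (Real.pi : ℂ) * Complex.I * (N : ℂ) * z)‖ =
      Real.exp (-r * (N : ℝ)) := by
    rw [Complex.norm_exp]
    congr 1
    simp [r]
    ring
  have hφN : ‖φ N‖ ≤ |C| * (N : ℝ) ^ ⌈M⌉₊ := by
    refine (hφ N (Nat.succ_pos n)).trans ?_
    rw [← Real.rpow_natCast]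
    gcongr
    · exact le_abs_self C
    · exact Nat.le_ceil M
  have hpow : ∀ d ∈ N.divisors, ‖(-1 : ℂ) ^ d * (d : ℂ) ^ m‖ ≤ (N : ℝ) ^ m.natAbs := by
    intro d hd
    have hd1 : (1 : ℝ) ≤ d := by exact_mod_cast Nat.pos_of_mem_divisors hd
    have hdN : (d : ℝ) ≤ N := by exact_mod_cast Nat.divisor_le hd
    calc ‖(-1 : ℂ) ^ d * (d : ℂ) ^ m‖ = (d : ℝ) ^ m := by simp
      _ ≤ (d : ℝ) ^ (m.natAbs : ℤ) := zpow_le_zpow_right₀ hd1 Int.le_natAbs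
      _ = (d : ℝ) ^ m.natAbs := zpow_natCast _ _
      _ ≤ (N : ℝ) ^ m.natAbs := by gcongr
  rw [tsum_fintype]
  calc _ ≤ ∑ _d : {d : ℕ // d ∈ N.divisors},
        (N : ℝ) ^ m.natAbs * (|C| * (N : ℝ) ^ ⌈M⌉₊) * Real.exp (-r * (N : ℝ)) := by
        refine Finset.sum_le_sum fun d _ => ?_
        rw [norm_mul, norm_mul, hexp]
        gcongr
        exact hpow d.1 d.2
    _ = (N.divisors.card : ℝ) *
        ((N : ℝ) ^ m.natAbs * (|C| * (N : ℝ) ^ ⌈M⌉₊) * Real.exp (-r * (N : ℝ))) := by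
        simp
    _ ≤ (N : ℝ) *
        ((N : ℝ) ^ m.natAbs * (|C| * (N : ℝ) ^ ⌈M⌉₊) * Real.exp (-r * (N : ℝ))) := by
        gcongr
        exact Nat.card_divisors_le_self N
    _ = |C| * ((N : ℝ) ^ k * Real.exp (-r * (N : ℝ))) := by
        simp only [k, pow_add, pow_one]
        ring

theorem stmt_11 (m : ℤ) (hm : Odd m) (z : ℂ) (hz : 0 < z.im)
    (φ : ℕ → ℂ) (C M : ℝ)
    (hφ : ∀ n : ℕ, 1 ≤ n → ‖φ n‖ ≤ C * (n : ℝ) ^ M) :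
    Summable (fun dd : {dd : ℤ × ℤ // 0 < dd.1 * dd.2 ∧ 2 ∣ dd.2} =>
      ‖(dd.1.1.sign : ℂ) * (dd.1.1 : ℂ) ^ m *
        Complex.exp ((Real.pi : ℂ) * Complex.I * (dd.1.1 : ℂ)) *
        φ ((dd.1.1 * dd.1.2 / 2).toNat) *
        Complex.exp ((Real.pi : ℂ) * Complex.I * (dd.1.1 : ℂ) * (dd.1.2 : ℂ) * z)‖) ∧
    (∑' dd : {dd : ℤ × ℤ // 0 < dd.1 * dd.2 ∧ 2 ∣ dd.2},
      (dd.1.1.sign : ℂ) * (dd.1.1 : ℂ) ^ m *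
        Complex.exp ((Real.pi : ℂ) * Complex.I * (dd.1.1 : ℂ)) *
        φ ((dd.1.1 * dd.1.2 / 2).toNat) *
        Complex.exp ((Real.pi : ℂ) * Complex.I * (dd.1.1 : ℂ) * (dd.1.2 : ℂ) * z)) =
      2 * ∑' n : ℕ,
        (∑ d ∈ (n + 1).divisors, (-1 : ℂ) ^ d * (d : ℂ) ^ m) * φ (n + 1) *
          Complex.exp (2 * (Real.pi : ℂ) * Complex.I * ((n + 1 : ℕ) : ℂ) * z) := by
  have hG := summable_norm_sigma_divisors m hz hφ
  set G : (Σ n : ℕ, {d : ℕ // d ∈ (n + 1).divisors}) → ℂ := fun x =>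
    (-1 : ℂ) ^ x.2.1 * (x.2.1 : ℂ) ^ m * φ (x.1 + 1) *
      Complex.exp (2 * (Real.pi : ℂ) * Complex.I * ((x.1 + 1 : ℕ) : ℂ) * z)
  set F : {dd : ℤ × ℤ // 0 < dd.1 * dd.2 ∧ 2 ∣ dd.2} → ℂ := fun dd =>
    (dd.1.1.sign : ℂ) * (dd.1.1 : ℂ) ^ m *
      Complex.exp ((Real.pi : ℂ) * Complex.I * (dd.1.1 : ℂ)) *
      φ ((dd.1.1 * dd.1.2 / 2).toNat) *
      Complex.exp ((Real.pi : ℂ) * Complex.I * (dd.1.1 : ℂ) * (dd.1.2 : ℂ) * z)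
  let e := Equiv.ofBijective signedDivisorPair
    ⟨signedDivisorPair_injective, signedDivisorPair_surjective⟩
  have hFG : ∀ x, F (e x) = G x.2 := fun ⟨ε, n, d, hd⟩ =>
    summand_signedDivisorPair hm z φ ε (Nat.pos_of_mem_divisors hd)
      (Nat.mul_div_cancel' (Nat.dvd_of_mem_divisors hd))
  have hsum : Summable fun x : ℤˣ × (Σ n : ℕ, {d : ℕ // d ∈ (n + 1).divisors}) => ‖G x.2‖ :=
    (summable_prod_of_nonneg fun _ => norm_nonneg _).2
      ⟨fun _ => hG, (hasSum_fintype _).summable⟩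
  refine ⟨?_, ?_⟩
  · rw [← e.summable_iff]
    exact hsum.congr fun x => congrArg norm (hFG x).symm
  · calc ∑' dd, F dd = ∑' x : ℤˣ × (Σ n : ℕ, {d : ℕ // d ∈ (n + 1).divisors}), G x.2 := by
          rw [← e.tsum_eq, tsum_congr hFG]
      _ = ∑ _ε : ℤˣ, ∑' x, G x := by rw [hsum.of_norm.tsum_prod, tsum_fintype]
      _ = 2 * ∑' x, G x := by
          rw [Finset.sum_const, Finset.card_univ, Fintype.card_units_int, nsmul_eq_mul,
            Nat.cast_ofNat]
      _ = _ := by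
          rw [Summable.tsum_sigma (f := G) hG.of_norm]
          congr 1
          refine tsum_congr fun n => ?_
          rw [tsum_fintype, Finset.sum_mul, Finset.sum_mul,
            ← Finset.sum_coe_sort (n + 1).divisors]
end
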